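/- For all 0 < ε ≤ 1, Δ(ε) = inf{g/n : n and g are integers with n ≥ g ≥ 1 and R(g,n)/n ≥ ε}. -/

import Mathlib

open MeasureTheory

/-- A set `C ⊆ ℝ` is symmetric if there is a center `c` with `c + x ∈ C ↔ c - x ∈ C`. -/
def IsSymmetricSet (C : Set ℝ) : Prop := ∃ c : ℝ, ∀ x : ℝ, c + x ∈ C ↔ c - x ∈ C

/-- `DD A` is the supremum of measures of measurable symmetric subsets of `A`. -/
noncomputable def DD (A : Set ℝ) : ℝ :=
  sSup {m : ℝ | ∃ C : Set ℝ, C ⊆ A ∧ MeasurableSet C ∧ IsSymmetricSet C ∧ m = (volume C).toReal}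

/-- `Δ ε` is the infimum of `DD A` over measurable `A ⊆ [0,1)` with measure `ε`. -/
noncomputable def Δ (ε : ℝ) : ℝ :=
  sInf {d : ℝ | ∃ A : Set ℝ, A ⊆ Set.Ico (0:ℝ) 1 ∧ MeasurableSet A ∧
    volume A = ENNReal.ofReal ε ∧ d = DD A}

/-- `S` is a B*[g] set: for every `m` there are at most `g` ordered pairs in `S × S`
summing to `m`. -/
def IsBStar (g : ℕ) (S : Finset ℤ) : Prop :=
  ∀ m : ℤ, ((S ×ˢ S).filter (fun p => p.1 + p.2 = m)).card ≤ g

/-- `R g n` is the largest cardinality of a B*[g] set contained in `{1, …, n}`. -/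
noncomputable def R (g n : ℕ) : ℕ :=
  sSup {k : ℕ | ∃ S : Finset ℤ, S ⊆ Finset.Icc 1 (n : ℤ) ∧ IsBStar g S ∧ S.card = k}

theorem DD_nonneg (A : Set ℝ) : 0 ≤ DD A :=
  Real.sSup_nonneg (by rintro _ ⟨C, -, -, -, rfl⟩; exact ENNReal.toReal_nonneg)

/-- The largest subset of `A` that is symmetric about `c`. -/
def symmPart (c : ℝ) (A : Set ℝ) : Set ℝ := A ∩ (fun x => 2 * c - x) ⁻¹' A

theorem symmPart_mono {c : ℝ} {A B : Set ℝ} (h : A ⊆ B) : symmPart c A ⊆ symmPart c B :=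
  Set.inter_subset_inter h (Set.preimage_mono h)

theorem measurableSet_symmPart {c : ℝ} {A : Set ℝ} (hA : MeasurableSet A) :
    MeasurableSet (symmPart c A) :=
  hA.inter (hA.preimage (by fun_prop))

theorem isSymmetricSet_symmPart (c : ℝ) (A : Set ℝ) : IsSymmetricSet (symmPart c A) := by
  refine ⟨c, fun x => ?_⟩
  simp only [symmPart, Set.mem_inter_iff, Set.mem_preimage]
  rw [show 2 * c - (c + x) = c - x by ring, show 2 * c - (c - x) = c + x by ring, and_comm]

theorem volume_ne_top_of_subset_Ico {A : Set ℝ} (hA : A ⊆ Set.Ico (0 : ℝ) 1) : volume A ≠ ⊤ :=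
  ne_top_of_le_ne_top (by simp) (measure_mono hA)

theorem DD_le {A : Set ℝ} (hA : A ⊆ Set.Ico (0 : ℝ) 1) {t : ℝ} (ht : 0 ≤ t)
    (h : ∀ c, volume.real (symmPart c A) ≤ t) : DD A ≤ t := by
  refine Real.sSup_le ?_ ht
  rintro _ ⟨C, hCA, -, ⟨c, hc⟩, rfl⟩
  have hsub : C ⊆ symmPart c A := fun x hx => by
    have := (hc (x - c)).1 (by simpa using hx)
    rw [show c - (x - c) = 2 * c - x by ring] at this
    exact ⟨hCA hx, hCA this⟩
  exact (measureReal_mono hsub (volume_ne_top_of_subset_Ico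
    (Set.inter_subset_left.trans hA))).trans (h c)

theorem le_DD {A : Set ℝ} (hA : A ⊆ Set.Ico (0 : ℝ) 1) (hm : MeasurableSet A) (c : ℝ) :
    volume.real (symmPart c A) ≤ DD A := by
  refine le_csSup ⟨volume.real A, ?_⟩
    ⟨symmPart c A, Set.inter_subset_left, measurableSet_symmPart hm,
      isSymmetricSet_symmPart c A, rfl⟩
  rintro _ ⟨C, hC, -, -, rfl⟩
  exact measureReal_mono hC (volume_ne_top_of_subset_Ico hA)

theorem volume_real_symmPart_le_add {A B : Set ℝ} (hA : A ⊆ Set.Ico (0 : ℝ) 1)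
    (hB : B ⊆ Set.Ico (0 : ℝ) 1) (hAm : MeasurableSet A) (hBm : MeasurableSet B) (c : ℝ) :
    volume.real (symmPart c B) ≤ DD A + 2 * volume.real (B \ A) := by
  set D := B \ A
  have hDm : MeasurableSet D := hBm.diff hAm
  have hDfin : volume D ≠ ⊤ := volume_ne_top_of_subset_Ico (Set.sdiff_subset.trans hB)
  have hrefl : volume ((fun x => 2 * c - x) ⁻¹' D) = volume D :=
    (Measure.measurePreserving_sub_left volume (2 * c)).measure_preimage hDm.nullMeasurableSet
  have hsub : symmPart c B ⊆ (symmPart c A ∪ D) ∪ (fun x => 2 * c - x) ⁻¹' D := by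
    rintro x ⟨h1, h2⟩
    simp only [symmPart, D, Set.mem_union, Set.mem_inter_iff, Set.mem_preimage, Set.mem_sdiff] at *
    tauto
  have hAfin : volume (symmPart c A) ≠ ⊤ :=
    volume_ne_top_of_subset_Ico (Set.inter_subset_left.trans hA)
  have h1 := measureReal_mono (μ := volume) hsub
    (measure_union_ne_top (measure_union_ne_top hAfin hDfin) (by rwa [hrefl]))
  have h2 := measureReal_union_le (μ := volume) (symmPart c A ∪ D) ((fun x => 2 * c - x) ⁻¹' D)
  have h3 := measureReal_union_le (μ := volume) (symmPart c A) D
  have h4 : volume.real ((fun x => 2 * c - x) ⁻¹' D) = volume.real D := by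
    simp only [measureReal_def, hrefl]
  have h5 := le_DD hA hAm c
  linarith

theorem exists_measurable_subset_volume_real_eq {B : Set ℝ} (hB : B ⊆ Set.Ico (0 : ℝ) 1)
    (hBm : MeasurableSet B) {ε : ℝ} (h0 : 0 ≤ ε) (h1 : ε ≤ volume.real B) :
    ∃ A ⊆ B, MeasurableSet A ∧ volume.real A = ε := by
  have hfin : ∀ t, volume (B ∩ Set.Iic t) ≠ ⊤ := fun t =>
    volume_ne_top_of_subset_Ico (Set.inter_subset_left.trans hB)
  have hlip : LipschitzWith 1 (fun t : ℝ => volume.real (B ∩ Set.Iic t)) := by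
    refine LipschitzWith.of_le_add fun x y => ?_
    have hsub : B ∩ Set.Iic x ⊆ (B ∩ Set.Iic y) ∪ Set.Ioc y x := by
      rintro z ⟨hz, hzx⟩
      rcases le_or_gt z y with h | h
      · exact Or.inl ⟨hz, h⟩
      · exact Or.inr ⟨h, hzx⟩
    have h2 := measureReal_mono (μ := volume) hsub (measure_union_ne_top (hfin y) (by simp))
    have h3 := measureReal_union_le (μ := volume) (B ∩ Set.Iic y) (Set.Ioc y x)
    have h4 : volume.real (Set.Ioc y x) ≤ dist x y := by
      rw [Real.volume_real_Ioc, Real.dist_eq]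
      exact max_le (le_abs_self _) (abs_nonneg _)
    linarith
  have hF0 : volume.real (B ∩ Set.Iic 0) = 0 := by
    refine le_antisymm ?_ measureReal_nonneg
    have hsub : B ∩ Set.Iic 0 ⊆ {(0 : ℝ)} := fun z hz => le_antisymm hz.2 (hB hz.1).1
    simpa [measureReal_def] using measureReal_mono (μ := volume) hsub (by simp)
  have hF1 : B ∩ Set.Iic 1 = B := Set.inter_eq_left.2 fun z hz => (hB hz).2.le
  obtain ⟨t, -, ht⟩ := intermediate_value_Icc (zero_le_one (α := ℝ)) hlip.continuous.continuousOn
    (show ε ∈ Set.Icc _ _ by simp only [hF0, hF1]; exact ⟨h0, h1⟩)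
  exact ⟨B ∩ Set.Iic t, Set.inter_subset_left, hBm.inter measurableSet_Iic, ht⟩

/-- The points `x` whose cell of width `1 / n`, counted from `1`, has its index in `T`, and whose
relative position in that cell lies in `J`. -/
def gridSet (n : ℕ) (T : Finset ℤ) (J : Set ℝ) : Set ℝ :=
  {x | ⌊(n : ℝ) * x⌋ + 1 ∈ T ∧ Int.fract ((n : ℝ) * x) ∈ J}

theorem measurableSet_gridSet (n : ℕ) (T : Finset ℤ) {J : Set ℝ} (hJ : MeasurableSet J) :
    MeasurableSet (gridSet n T J) := by
  have h : Measurable fun x : ℝ => ⌊(n : ℝ) * x⌋ + 1 :=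
    (Int.measurable_floor.comp (measurable_const_mul _)).add_const 1
  exact (h (MeasurableSet.of_discrete (s := (T : Set ℤ)))).inter
    ((measurable_fract.comp (measurable_const_mul _)) hJ)

theorem volume_floor_mem_fract_mem (T : Finset ℤ) {J : Set ℝ} (hJ : MeasurableSet J) :
    volume {x : ℝ | ⌊x⌋ + 1 ∈ T ∧ Int.fract x ∈ J} = T.card * volume (J ∩ Set.Ico 0 1) := by
  have key : ∀ (k : ℤ) (x : ℝ), x + (1 - k : ℝ) ∈ J ∩ Set.Ico (0 : ℝ) 1 ↔
      ⌊x⌋ + 1 = k ∧ Int.fract x ∈ J := by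
    intro k x
    constructor
    · rintro ⟨hJx, h0, h1⟩
      have hf : ⌊x⌋ = k - 1 := by
        rw [Int.floor_eq_iff]; push_cast; constructor <;> linarith
      refine ⟨by omega, ?_⟩
      rwa [Int.fract, hf, show x - ((k - 1 : ℤ) : ℝ) = x + (1 - k) by push_cast; ring]
    · rintro ⟨rfl, hx⟩
      rw [show x + (1 - ((⌊x⌋ + 1 : ℤ) : ℝ)) = Int.fract x by
        push_cast; rw [Int.fract]; ring]
      exact ⟨hx, Int.fract_nonneg x, Int.fract_lt_one x⟩
  have hU : {x : ℝ | ⌊x⌋ + 1 ∈ T ∧ Int.fract x ∈ J} =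
      ⋃ k ∈ T, (fun x : ℝ => x + (1 - k : ℝ)) ⁻¹' (J ∩ Set.Ico 0 1) := by
    ext x
    simp only [Set.mem_iUnion, Set.mem_preimage, key, Set.mem_ofPred_eq, exists_prop]
    exact ⟨fun h => ⟨_, h.1, rfl, h.2⟩, fun ⟨k, hk, h, hx⟩ => ⟨h ▸ hk, hx⟩⟩
  rw [hU, measure_biUnion_finset]
  · simp only [measure_preimage_add_right, Finset.sum_const, nsmul_eq_mul]
  · intro a _ b _ hab
    refine Set.disjoint_left.2 fun x hxa hxb => hab ?_
    rw [← ((key a x).1 hxa).1, ← ((key b x).1 hxb).1]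
  · intro k _
    exact (hJ.inter measurableSet_Ico).preimage (measurable_add_const _)

theorem volume_gridSet {n : ℕ} (hn : 0 < n) (T : Finset ℤ) {J : Set ℝ} (hJ : MeasurableSet J) :
    volume (gridSet n T J) =
      ENNReal.ofReal |(n : ℝ)⁻¹| * (T.card * volume (J ∩ Set.Ico 0 1)) := by
  rw [← volume_floor_mem_fract_mem T hJ, ← Real.volume_preimage_mul_left (by positivity)]
  rfl

theorem volume_real_gridSet {n : ℕ} (hn : 0 < n) (T : Finset ℤ) {J : Set ℝ}
    (hJ : MeasurableSet J) :
    volume.real (gridSet n T J) = T.card * volume.real (J ∩ Set.Ico 0 1) / n := by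
  rw [measureReal_def, volume_gridSet hn T hJ, ENNReal.toReal_mul, ENNReal.toReal_mul,
    ENNReal.toReal_ofReal (abs_nonneg _), abs_of_nonneg (by positivity), ENNReal.toReal_natCast,
    measureReal_def, inv_mul_eq_div]

theorem volume_gridSet_ne_top {n : ℕ} (hn : 0 < n) (T : Finset ℤ) {J : Set ℝ}
    (hJ : MeasurableSet J) : volume (gridSet n T J) ≠ ⊤ := by
  rw [volume_gridSet hn T hJ]
  refine ENNReal.mul_ne_top ENNReal.ofReal_ne_top (ENNReal.mul_ne_top (by simp) ?_)
  exact volume_ne_top_of_subset_Ico Set.inter_subset_right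

theorem volume_real_gridSet_univ {n : ℕ} (hn : 0 < n) (T : Finset ℤ) :
    volume.real (gridSet n T Set.univ) = T.card / n := by
  simp [volume_real_gridSet hn T MeasurableSet.univ]

theorem gridSet_subset_Ico {n : ℕ} (hn : 0 < n) {S : Finset ℤ} (hS : S ⊆ Finset.Icc 1 (n : ℤ))
    (J : Set ℝ) : gridSet n S J ⊆ Set.Ico 0 1 := by
  rintro x ⟨hx, -⟩
  have hn' : (0 : ℝ) < n := by exact_mod_cast hn
  have h := Finset.mem_Icc.1 (hS hx)
  have h1 : (0 : ℤ) ≤ ⌊(n : ℝ) * x⌋ := by omega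
  have h2 : ⌊(n : ℝ) * x⌋ < (n : ℤ) := by omega
  rw [Int.floor_nonneg] at h1
  rw [Int.floor_lt, Int.cast_natCast] at h2
  exact ⟨nonneg_of_mul_nonneg_right h1 hn', by nlinarith⟩

/-- The number of ordered pairs in `S × S` with sum `m`. -/
def repCount (S : Finset ℤ) (m : ℤ) : ℕ := ((S ×ˢ S).filter (fun p => p.1 + p.2 = m)).card

theorem repCount_eq (S : Finset ℤ) (m : ℤ) :
    repCount S m = (S.filter (fun s => m - s ∈ S)).card := by
  refine Finset.card_nbij' (fun p => p.1) (fun s => (s, m - s)) ?_ ?_ ?_ ?_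
  · rintro ⟨a, b⟩ h
    simp only [Finset.coe_filter, Finset.mem_product, Set.mem_ofPred_eq] at h ⊢
    obtain ⟨⟨ha, hb⟩, rfl⟩ := h
    simpa [ha] using hb
  · intro s h
    simp only [Finset.coe_filter, Finset.mem_product, Set.mem_ofPred_eq] at h ⊢
    exact ⟨h, by ring⟩
  · rintro ⟨a, b⟩ h
    simp only [Finset.coe_filter, Finset.mem_product, Set.mem_ofPred_eq] at h ⊢
    simp [← h.2]
  · intro s _
    rfl

theorem volume_real_symmPart_gridSet_le {n g : ℕ} (hn : 0 < n) {S : Finset ℤ} (hS : IsBStar g S)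
    (c : ℝ) : volume.real (symmPart c (gridSet n S Set.univ)) ≤ (g : ℝ) / n := by
  set N : ℝ := n * (2 * c)
  set θ := Int.fract N
  set T₁ := S.filter (fun s => (⌊N⌋ + 2) - s ∈ S)
  set T₂ := S.filter (fun s => (⌊N⌋ + 1) - s ∈ S)
  have hT₁ : (T₁.card : ℝ) ≤ g := by
    exact_mod_cast (repCount_eq S _).symm.trans_le (hS (⌊N⌋ + 2))
  have hT₂ : (T₂.card : ℝ) ≤ g := by
    exact_mod_cast (repCount_eq S _).symm.trans_le (hS (⌊N⌋ + 1))
  have hsub : symmPart c (gridSet n S Set.univ) ⊆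
      gridSet n T₁ (Set.Iic θ) ∪ gridSet n T₂ (Set.Iic θ)ᶜ := by
    rintro x ⟨⟨hx, -⟩, ⟨hx', -⟩⟩
    rw [show (n : ℝ) * (2 * c - x) = N - n * x by simp only [N]; ring] at hx'
    set y := (n : ℝ) * x
    have hN : (⌊N⌋ : ℝ) + θ = N := Int.floor_add_fract N
    have hY : (⌊y⌋ : ℝ) + Int.fract y = y := Int.floor_add_fract y
    have hθ1 : θ < 1 := Int.fract_lt_one N
    have hθ0 : 0 ≤ θ := Int.fract_nonneg N
    have hy0 := Int.fract_nonneg y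
    have hy1 := Int.fract_lt_one y
    rcases le_or_gt (Int.fract y) θ with h | h
    · have hf : ⌊N - y⌋ = ⌊N⌋ - ⌊y⌋ := by
        rw [Int.floor_eq_iff]; push_cast; constructor <;> linarith
      refine Or.inl ⟨Finset.mem_filter.2 ⟨hx, ?_⟩, h⟩
      rw [hf] at hx'
      convert hx' using 1
      ring
    · have hf : ⌊N - y⌋ = ⌊N⌋ - ⌊y⌋ - 1 := by
        rw [Int.floor_eq_iff]; push_cast; constructor <;> linarith
      refine Or.inr ⟨Finset.mem_filter.2 ⟨hx, ?_⟩, not_le.2 h⟩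
      rw [hf] at hx'
      convert hx' using 1
      ring
  have hJ : MeasurableSet (Set.Iic θ) := measurableSet_Iic
  have h1 := measureReal_mono (μ := volume) hsub (measure_union_ne_top
    (volume_gridSet_ne_top hn T₁ hJ) (volume_gridSet_ne_top hn T₂ hJ.compl))
  have h2 := measureReal_union_le (μ := volume) (gridSet n T₁ (Set.Iic θ))
    (gridSet n T₂ (Set.Iic θ)ᶜ)
  rw [volume_real_gridSet hn T₁ hJ, volume_real_gridSet hn T₂ hJ.compl] at h2
  have h3 : volume.real (Set.Iic θ ∩ Set.Ico 0 1) + volume.real ((Set.Iic θ)ᶜ ∩ Set.Ico 0 1)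
      = 1 := by
    have := measureReal_inter_add_sdiff (μ := volume) (s := Set.Ico (0 : ℝ) 1) hJ
      (by simp)
    rw [Set.sdiff_eq, Set.inter_comm, Set.inter_comm _ (Set.Iic θ)ᶜ] at this
    simpa using this
  refine h1.trans (h2.trans ?_)
  rw [← add_div]
  gcongr
  calc _ ≤ (g : ℝ) * volume.real (Set.Iic θ ∩ Set.Ico 0 1)
        + g * volume.real ((Set.Iic θ)ᶜ ∩ Set.Ico 0 1) := by gcongr
    _ = g := by rw [← mul_add, h3, mul_one]

theorem repCount_div_le {n : ℕ} (hn : 0 < n) {S : Finset ℤ} (hS : S ⊆ Finset.Icc 1 (n : ℤ))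
    (m : ℤ) :
    (repCount S m : ℝ) / n ≤
      volume.real (symmPart ((m - 1) / (2 * n)) (gridSet n S Set.univ)) := by
  have hn' : (n : ℝ) ≠ 0 := by positivity
  have hI : volume.real (Set.Ioi (0 : ℝ) ∩ Set.Ico 0 1) = 1 := by
    rw [show Set.Ioi (0 : ℝ) ∩ Set.Ico 0 1 = Set.Ioo 0 1 by ext; simp; grind]
    simp
  have h := volume_real_gridSet hn (S.filter (fun s => m - s ∈ S))
    (measurableSet_Ioi (a := (0 : ℝ)))
  rw [hI, mul_one, ← repCount_eq] at h
  rw [← h]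
  refine measureReal_mono ?_ (volume_ne_top_of_subset_Ico
    (Set.inter_subset_left.trans (gridSet_subset_Ico hn hS _)))
  rintro x ⟨hx, hx0⟩
  obtain ⟨hx1, hx2⟩ := Finset.mem_filter.1 hx
  refine ⟨⟨hx1, trivial⟩, ?_, trivial⟩
  have hf : ⌊(n : ℝ) * (2 * ((m - 1) / (2 * n)) - x)⌋ = m - (⌊(n : ℝ) * x⌋ + 1) - 1 := by
    rw [show (n : ℝ) * (2 * ((m - 1) / (2 * n)) - x) = m - 1 - n * x by field_simp]
    have hY := Int.floor_add_fract ((n : ℝ) * x)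
    have hy1 := Int.fract_lt_one ((n : ℝ) * x)
    have hx0' : 0 < Int.fract ((n : ℝ) * x) := hx0
    rw [Int.floor_eq_iff]; push_cast; constructor <;> linarith
  rw [hf, sub_add_cancel]
  exact hx2

theorem bddAbove_card_isBStar (g n : ℕ) :
    BddAbove {k : ℕ | ∃ S : Finset ℤ, S ⊆ Finset.Icc 1 (n : ℤ) ∧ IsBStar g S ∧ S.card = k} := by
  refine ⟨n, ?_⟩
  rintro _ ⟨S, hS, -, rfl⟩
  simpa using Finset.card_le_card hS

theorem exists_isBStar_card_eq_R (g n : ℕ) :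
    ∃ S : Finset ℤ, S ⊆ Finset.Icc 1 (n : ℤ) ∧ IsBStar g S ∧ S.card = R g n :=
  Nat.sSup_mem (s := {k : ℕ | ∃ S : Finset ℤ, S ⊆ Finset.Icc 1 (n : ℤ) ∧ IsBStar g S ∧ S.card = k})
    ⟨0, ∅, by simp, fun m => by simp, rfl⟩ (bddAbove_card_isBStar g n)

theorem card_le_R {g n : ℕ} {S : Finset ℤ} (hS : S ⊆ Finset.Icc 1 (n : ℤ)) (h : IsBStar g S) :
    S.card ≤ R g n :=
  le_csSup (bddAbove_card_isBStar g n) ⟨S, hS, h, rfl⟩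

theorem exists_DD_le_of_le_R {ε : ℝ} (hε0 : 0 < ε) {g n : ℕ} (hn : 0 < n)
    (h : ε ≤ (R g n : ℝ) / n) :
    ∃ A : Set ℝ, A ⊆ Set.Ico (0 : ℝ) 1 ∧ MeasurableSet A ∧
      volume A = ENNReal.ofReal ε ∧ DD A ≤ (g : ℝ) / n := by
  obtain ⟨S, hS, hB, hcard⟩ := exists_isBStar_card_eq_R g n
  rw [← hcard, ← volume_real_gridSet_univ hn S] at h
  have hI := gridSet_subset_Ico hn hS Set.univ
  obtain ⟨A, hAB, hAm, hA⟩ := exists_measurable_subset_volume_real_eq hI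
    (measurableSet_gridSet n S .univ) hε0.le h
  have hAI := hAB.trans hI
  refine ⟨A, hAI, hAm, ?_, DD_le hAI (by positivity) fun c => ?_⟩
  · rw [← hA, ofReal_measureReal (volume_ne_top_of_subset_Ico hAI)]
  · exact (measureReal_mono (symmPart_mono hAB) (volume_ne_top_of_subset_Ico
      (Set.inter_subset_left.trans hI))).trans (volume_real_symmPart_gridSet_le hn hB c)

theorem exists_isBStar_of_symmPart_le {n : ℕ} (hn : 0 < n) {S : Finset ℤ}
    (hS : S ⊆ Finset.Icc 1 (n : ℤ)) (hne : S.Nonempty) {t : ℝ}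
    (ht : ∀ c, volume.real (symmPart c (gridSet n S Set.univ)) ≤ t) :
    ∃ g : ℕ, 1 ≤ g ∧ g ≤ n ∧ IsBStar g S ∧ (g : ℝ) / n ≤ t := by
  obtain ⟨p, hp, hmax⟩ := (S ×ˢ S).exists_max_image (fun p => repCount S (p.1 + p.2))
    (hne.product hne)
  refine ⟨repCount S (p.1 + p.2), ?_, ?_, fun m => ?_, (repCount_div_le hn hS _).trans (ht _)⟩
  · exact Finset.card_pos.2 ⟨p, Finset.mem_filter.2 ⟨hp, rfl⟩⟩
  · rw [repCount_eq]
    simpa using Finset.card_le_card ((Finset.filter_subset _ S).trans hS)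
  · rcases Finset.eq_empty_or_nonempty ((S ×ˢ S).filter (fun p => p.1 + p.2 = m)) with h | ⟨q, hq⟩
    · simp [h]
    · obtain ⟨hqS, rfl⟩ := Finset.mem_filter.1 hq
      exact hmax q hqS

theorem exists_gridSet_approx {A : Set ℝ} (hA : A ⊆ Set.Ico (0 : ℝ) 1) (hAm : MeasurableSet A)
    (h0 : 0 < volume.real A) {η : ℝ} (hη : 0 < η) :
    ∃ (n : ℕ) (S : Finset ℤ), 0 < n ∧ S ⊆ Finset.Icc 1 (n : ℤ) ∧
      volume.real A ≤ (S.card : ℝ) / n ∧ volume.real (gridSet n S Set.univ \ A) ≤ η := by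
  classical
  have hAfin := volume_ne_top_of_subset_Ico hA
  obtain ⟨K, hKA, hK, hKlt⟩ := hAm.exists_isCompact_lt_add hAfin
    (ε := ENNReal.ofReal (η / 2)) (by simpa using hη)
  have hKI := hKA.trans hA
  have hKfin := volume_ne_top_of_subset_Ico hKI
  have hKreal : volume.real A ≤ volume.real K + η / 2 := by
    have := ENNReal.toReal_mono (by simp [hKfin]) hKlt.le
    rwa [ENNReal.toReal_add hKfin (by simp), ENNReal.toReal_ofReal (by positivity)] at this
  obtain ⟨n, hn, hnη, hthick⟩ : ∃ n : ℕ, 0 < n ∧ 1 / (n : ℝ) ≤ η / 2 ∧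
      volume (Metric.cthickening (1 / (n : ℝ)) K) ≤ volume K + ENNReal.ofReal η := by
    have h1 : Filter.Tendsto (fun n : ℕ => 1 / (n : ℝ)) Filter.atTop (nhds 0) :=
      tendsto_one_div_atTop_nhds_zero_nat
    have h2 := (tendsto_measure_cthickening_of_isCompact (μ := volume) hK).comp h1
    have h3 := h2.eventually (Iic_mem_nhds (ENNReal.lt_add_right hKfin
      (by simpa using hη : ENNReal.ofReal η ≠ 0)))
    have h4 := h1.eventually (Iic_mem_nhds (half_pos hη))
    obtain ⟨n, hn, hn', hn''⟩ := ((Filter.eventually_gt_atTop 0).and (h4.and h3)).exists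
    exact ⟨n, hn, hn', hn''⟩
  have hn' : (0 : ℝ) < n := by exact_mod_cast hn
  set S₀ := (Finset.Icc 1 (n : ℤ)).filter (fun s => ∃ x ∈ K, ⌊(n : ℝ) * x⌋ + 1 = s)
  have hA1 : volume.real A ≤ 1 := by
    simpa using measureReal_mono (μ := volume) hA (by simp)
  have hS₀ : (S₀.card : ℝ) / n ≤ volume.real K + η := by
    rw [← volume_real_gridSet_univ hn S₀]
    have hsub : gridSet n S₀ Set.univ ⊆ Metric.cthickening (1 / (n : ℝ)) K := by
      rintro x ⟨hx, -⟩
      obtain ⟨-, y, hy, hxy⟩ := Finset.mem_filter.1 hx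
      refine Metric.mem_cthickening_of_dist_le x y _ K hy ?_
      have h := Int.abs_sub_lt_one_of_floor_eq_floor (add_right_cancel hxy)
      rw [← mul_sub, abs_mul, abs_of_pos hn', abs_sub_comm] at h
      rw [Real.dist_eq, le_div_iff₀ hn', mul_comm]
      exact h.le
    have := ENNReal.toReal_mono (by simp [hKfin]) ((measure_mono hsub).trans hthick)
    rwa [ENNReal.toReal_add hKfin (by simp), ENNReal.toReal_ofReal hη.le] at this
  have hceil : ⌈volume.real A * n⌉₊ ≤ n := Nat.ceil_le.2 (by nlinarith)
  have hS₀n : S₀ ⊆ Finset.Icc 1 (n : ℤ) := Finset.filter_subset _ _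
  have hcard₀ : S₀.card ≤ n := by simpa using Finset.card_le_card hS₀n
  obtain ⟨S, hS₀S, hS, hcard⟩ := Finset.exists_subsuperset_card_eq hS₀n
    (le_max_left S₀.card ⌈volume.real A * n⌉₊) (by simp [hceil, hcard₀])
  refine ⟨n, S, hn, hS, ?_, ?_⟩
  · rw [le_div_iff₀ hn', hcard]
    exact (Nat.le_ceil _).trans (by exact_mod_cast le_max_right _ _)
  · have hKS : K ⊆ gridSet n S Set.univ := by
      intro x hx
      refine ⟨hS₀S (Finset.mem_filter.2 ⟨?_, x, hx, rfl⟩), trivial⟩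
      obtain ⟨hx0, hx1⟩ := hKI hx
      have h1 : (0 : ℤ) ≤ ⌊(n : ℝ) * x⌋ := Int.floor_nonneg.2 (by positivity)
      have h2 : ⌊(n : ℝ) * x⌋ < (n : ℤ) := Int.floor_lt.2 (by rw [Int.cast_natCast]; nlinarith)
      rw [Finset.mem_Icc]
      omega
    have hSfin := volume_gridSet_ne_top hn S MeasurableSet.univ
    have h1 : volume.real (gridSet n S Set.univ \ A) ≤ volume.real (gridSet n S Set.univ \ K) :=
      measureReal_mono (Set.sdiff_subset_sdiff_right hKA)
        (ne_top_of_le_ne_top hSfin (measure_mono Set.sdiff_subset))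
    rw [measureReal_sdiff hKS hK.measurableSet hSfin, volume_real_gridSet_univ hn S] at h1
    have h2 : (S.card : ℝ) / n ≤ volume.real K + η := by
      rw [hcard]
      rcases max_choice S₀.card ⌈volume.real A * n⌉₊ with h | h
      · rw [h]; exact hS₀
      · rw [h]
        have := Nat.ceil_lt_add_one (a := volume.real A * n) (by positivity)
        calc (⌈volume.real A * n⌉₊ : ℝ) / n ≤ (volume.real A * n + 1) / n := by gcongr
          _ = volume.real A + 1 / n := by field_simp
          _ ≤ _ := by linarith
    linarith

theorem delta_as_infimum (ε : ℝ) (hε0 : 0 < ε) (hε1 : ε ≤ 1) :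
    Δ ε = sInf {q : ℝ | ∃ g n : ℕ, 1 ≤ g ∧ g ≤ n ∧ ε ≤ (R g n : ℝ) / n ∧ q = (g : ℝ) / n} := by
  have hsub : Set.Ico (0 : ℝ) ε ⊆ Set.Ico 0 1 := Set.Ico_subset_Ico_right hε1
  have key : ∀ A : Set ℝ, A ⊆ Set.Ico (0 : ℝ) 1 → MeasurableSet A →
      volume A = ENNReal.ofReal ε → ∀ η > 0, ∃ g n : ℕ, 1 ≤ g ∧ g ≤ n ∧ ε ≤ (R g n : ℝ) / n ∧
        (g : ℝ) / n ≤ DD A + η := by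
    intro A hA hAm hAε η hη
    have hAr : volume.real A = ε := by rw [measureReal_def, hAε, ENNReal.toReal_ofReal hε0.le]
    obtain ⟨n, S, hn, hS, hcard, hdiff⟩ :=
      exists_gridSet_approx hA hAm (hAr ▸ hε0) (half_pos hη)
    rw [hAr] at hcard
    have hne : S.Nonempty := by
      rw [Finset.nonempty_iff_ne_empty]
      rintro rfl
      simp only [Finset.card_empty, Nat.cast_zero, zero_div] at hcard
      linarith
    obtain ⟨g, hg, hgn, hB, hle⟩ := exists_isBStar_of_symmPart_le hn hS hne (t := DD A + η)
      fun c => (volume_real_symmPart_le_add hA (gridSet_subset_Ico hn hS _) hAm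
        (measurableSet_gridSet n S .univ) c).trans (by linarith)
    refine ⟨g, n, hg, hgn, hcard.trans ?_, hle⟩
    gcongr
    exact card_le_R hS hB
  apply le_antisymm
  · refine le_csInf ?_ ?_
    · obtain ⟨g, n, hg, hgn, h, -⟩ := key _ hsub measurableSet_Ico (by simp) 1 one_pos
      exact ⟨_, g, n, hg, hgn, h, rfl⟩
    · rintro _ ⟨g, n, hg, hgn, h, rfl⟩
      obtain ⟨A, hA, hAm, hAε, hle⟩ := exists_DD_le_of_le_R hε0 (hg.trans hgn) h
      refine csInf_le_of_le ⟨0, ?_⟩ ⟨A, hA, hAm, hAε, rfl⟩ hle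
      rintro _ ⟨B, -, -, -, rfl⟩
      exact DD_nonneg B
  · refine le_csInf ⟨_, _, hsub, measurableSet_Ico, by simp, rfl⟩ ?_
    rintro _ ⟨A, hA, hAm, hAε, rfl⟩
    refine le_of_forall_pos_le_add fun η hη => ?_
    obtain ⟨g, n, hg, hgn, h, hle⟩ := key A hA hAm hAε η hη
    refine csInf_le_of_le ⟨0, ?_⟩ ⟨g, n, hg, hgn, h, rfl⟩ hle
    rintro _ ⟨g, n, -, -, -, rfl⟩
    positivity
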